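/- There is no twice continuously differentiable function k : ℝ² → ℝ, real number α ∈ (0,1), and radius r > 0 such that x·∇k(x) ≤ −|x|^{1+α} for all x ∈ ℝ² with 0 < |x| ≤ r. In other words, the Merle nonexistence condition x·∇k(x) ≤ −|x|^{1+α} near the origin is incompatible with k being C². -/

import Mathlib

open RealInnerProductSpace

noncomputable section

abbrev E2 := EuclideanSpace ℝ (Fin 2)

/-- The Merle nonexistence condition `x·∇k(x) ≤ −|x|^{1+α}` near the origin is
incompatible with `k` being `C²`. -/
theorem stmt1 :
    ¬ ∃ (k : E2 → ℝ) (α r : ℝ), ContDiff ℝ 2 k ∧ α ∈ Set.Ioo (0 : ℝ) 1 ∧ 0 < r ∧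
      ∀ x : E2, 0 < ‖x‖ → ‖x‖ ≤ r → ⟪x, gradient k x⟫ ≤ -(‖x‖ ^ (1 + α)) := by
  rintro ⟨k, α, r, hk, ⟨hα0, hα1⟩, hr, H⟩
  obtain ⟨e, he⟩ : ∃ e : E2, ‖e‖ = 1 := exists_norm_eq E2 zero_le_one
  have hd : Differentiable ℝ (fderiv ℝ k) :=
    (hk.fderiv_right (m := 1) (by norm_num)).differentiable (by norm_num)
  let G : ℝ → ℝ := fun t => fderiv ℝ k (-t • e) e - fderiv ℝ k (t • e) e
  have hG : Differentiable ℝ G := by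
    have h1 : Differentiable ℝ fun t : ℝ => fderiv ℝ k (-t • e) :=
      hd.comp (by fun_prop)
    have h2 : Differentiable ℝ fun t : ℝ => fderiv ℝ k (t • e) :=
      hd.comp (by fun_prop)
    exact (h1.clm_apply (differentiable_const e)).sub (h2.clm_apply (differentiable_const e))
  have hH : ∀ x : E2, 0 < ‖x‖ → ‖x‖ ≤ r → fderiv ℝ k x x ≤ -(‖x‖ ^ (1 + α)) := by
    intro x h1 h2
    have := H x h1 h2
    rwa [real_inner_comm, gradient, InnerProductSpace.toDual_symm_apply] at this
  have hlim := (hG 0).hasDerivAt.tendsto_slope_zero_right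
  have hinf : Filter.Tendsto (fun t : ℝ => t ^ (α - 1)) (nhdsWithin 0 (Set.Ioi 0)) Filter.atTop :=
    tendsto_rpow_neg_nhdsGT_zero (by linarith)
  refine not_tendsto_nhds_of_tendsto_atTop (Filter.tendsto_atTop_mono' _ ?_ hinf) _ hlim
  filter_upwards [Ioc_mem_nhdsGT hr] with t ht
  obtain ⟨ht0, htr⟩ := ht
  have n1 : ‖t • e‖ = t := by rw [norm_smul, he, Real.norm_eq_abs, abs_of_pos ht0, mul_one]
  have n2 : ‖-t • e‖ = t := by rw [neg_smul, norm_neg, n1]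
  have a1 := hH (t • e) (by rw [n1]; exact ht0) (by rw [n1]; exact htr)
  have a2 := hH (-t • e) (by rw [n2]; exact ht0) (by rw [n2]; exact htr)
  rw [n1, map_smul, smul_eq_mul] at a1
  rw [n2, map_smul, smul_eq_mul] at a2
  have G0 : G 0 = 0 := by simp [G]
  have hp : t ^ (1 + α) = t ^ (α - 1) * t * t := by
    rw [← Real.rpow_add_one ht0.ne', ← Real.rpow_add_one ht0.ne']; congr 1; ring
  have hpos : 0 < t ^ (α - 1) := Real.rpow_pos_of_pos ht0 _
  rw [G0, zero_add, sub_zero, smul_eq_mul, inv_mul_eq_div, le_div_iff₀ ht0]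
  have h3 : t * (t ^ (α - 1) * t) ≤ t * G t := by
    simp only [G]
    have : 0 < t ^ (α - 1) * t * t := by positivity
    rw [hp] at a1 a2
    linarith
  exact le_of_mul_le_mul_left h3 ht0
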